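/- Suppose (m+M)/(2mM) < ζ < ε/(8M²). Let β, φ > 1 and set δ_a := 2mM/((m+M)ε) − 1/(εζ) and δ_b := min{ (αε − 8M²αζ)(φ−1)(β−1)λ₂ / (βε²(φ−1) + 8M²β(β−1)φ), 2αλ₂/((m+M)φβ) }. Let 0 < δ ≤ min{δ_a, δ_b} and 0 < δ̃ < δ. If η_k² ≤ min{ δ̃αε / (4(M+2α)²(αζ + δβφ/((φ−1)λ₂))), δ̃ / (8(αζ + δβφ/((φ−1)λ₂))) }, then ‖u^{k+1} − u*‖²_G ≤ ((1 + δ̃)/(1 + δ)) ‖u^k − u*‖²_G. -/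

import Mathlib

open scoped Kronecker RealInnerProductSpace
open Filter Topology

/-- Spectral norm (ℓ2 operator norm) of a real square matrix. -/
noncomputable def specNorm {ι : Type*} [Fintype ι] [DecidableEq ι] (A : Matrix ι ι ℝ) : ℝ :=
  ‖Matrix.toEuclideanCLM (𝕜 := ℝ) A‖

/-- Action of a matrix on a vector of Euclidean space. -/
noncomputable def mApp {ι : Type*} [Fintype ι] [DecidableEq ι]
    (A : Matrix ι ι ℝ) (x : EuclideanSpace ℝ ι) : EuclideanSpace ℝ ι :=
  Matrix.toEuclideanCLM (𝕜 := ℝ) A x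

/-- Spectral radius of a real square matrix (computed over ℂ). -/
noncomputable def specRad {ι : Type*} [Fintype ι] [DecidableEq ι] (A : Matrix ι ι ℝ) : ℝ :=
  (spectralRadius ℂ (A.map (Complex.ofReal : ℝ → ℂ))).toReal

/-- The matrix 𝕎 = W ⊗ Iₙ. -/
noncomputable def WW (N n : ℕ) (W : Matrix (Fin N) (Fin N) ℝ) :
    Matrix (Fin N × Fin n) (Fin N × Fin n) ℝ :=
  Matrix.kroneckerMap (· * ·) W (1 : Matrix (Fin n) (Fin n) ℝ)

/-- The i-th block component xᵢ ∈ ℝⁿ of x ∈ ℝ^{nN}. -/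
noncomputable def comp (N n : ℕ) (x : EuclideanSpace ℝ (Fin N × Fin n)) (i : Fin N) :
    EuclideanSpace ℝ (Fin n) :=
  (EuclideanSpace.equiv (Fin n) ℝ).symm fun j => x (i, j)

/-- The block-diagonal Hessian ∇²f(x) of f(x) = Σᵢ fᵢ(xᵢ), from local Hessians HF i. -/
noncomputable def blockHess (N n : ℕ)
    (HF : Fin N → EuclideanSpace ℝ (Fin n) → Matrix (Fin n) (Fin n) ℝ)
    (x : EuclideanSpace ℝ (Fin N × Fin n)) :
    Matrix (Fin N × Fin n) (Fin N × Fin n) ℝ :=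
  Matrix.of fun p q =>
    if p.1 = q.1 then HF p.1 (comp N n x p.1) p.2 q.2 else 0

/-- The block norm ‖𝕋‖_b = max_i Σ_j ‖T_{ij}‖₂. -/
noncomputable def blockNorm {N n : ℕ} (T : Matrix (Fin N × Fin n) (Fin N × Fin n) ℝ) : ℝ :=
  ⨆ i : Fin N, ∑ j : Fin N, specNorm (Matrix.of fun (a b : Fin n) => T (i, a) (j, b))

section InnerProduct

variable {E : Type*} [NormedAddCommGroup E] [InnerProductSpace ℝ E]

/-- A symmetric operator whose quadratic form is bounded by `r` has norm at most `r`. -/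
lemma norm_le_of_abs_inner_self_le {T : E →L[ℝ] E} (hT : ∀ x y, ⟪T x, y⟫ = ⟪x, T y⟫) {r : ℝ}
    (hr : 0 ≤ r) (hlow : ∀ x, -(r * ‖x‖ ^ 2) ≤ ⟪x, T x⟫) (hup : ∀ x, ⟪x, T x⟫ ≤ r * ‖x‖ ^ 2) :
    ‖T‖ ≤ r := by
  refine T.opNorm_le_bound hr fun x => ?_
  have key : ∀ s : ℝ, 2 * s * ‖T x‖ ^ 2 ≤ r * (‖x‖ ^ 2 + s ^ 2 * ‖T x‖ ^ 2) := by
    intro s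
    have h1 := hup (x + s • T x)
    have h2 := hlow (x - s • T x)
    have h3 : ⟪x, T (T x)⟫ = ‖T x‖ ^ 2 := by rw [← hT, real_inner_self_eq_norm_sq]
    rw [norm_add_sq_real, inner_smul_right, norm_smul, mul_pow, Real.norm_eq_abs, sq_abs] at h1
    rw [norm_sub_sq_real, inner_smul_right, norm_smul, mul_pow, Real.norm_eq_abs, sq_abs] at h2
    simp only [map_add, map_sub, map_smul, inner_add_left, inner_add_right, inner_sub_left,
      inner_sub_right, inner_smul_left, inner_smul_right, h3, real_inner_self_eq_norm_sq,
      conj_trivial] at h1 h2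
    linarith
  rcases hr.eq_or_lt with rfl | hr
  · have := key 1
    have h0 : ‖T x‖ ^ 2 ≤ 0 := by linarith
    simp [pow_eq_zero_iff two_ne_zero |>.1 (le_antisymm h0 (sq_nonneg _))]
  · have := key r⁻¹
    have h1 : ‖T x‖ ^ 2 ≤ (r * ‖x‖) ^ 2 := by
      have h2 := mul_le_mul_of_nonneg_left this hr.le
      have e1 : r * (2 * r⁻¹ * ‖T x‖ ^ 2) = 2 * ‖T x‖ ^ 2 := by field_simp
      have e2 : r * (r * (‖x‖ ^ 2 + r⁻¹ ^ 2 * ‖T x‖ ^ 2)) = (r * ‖x‖) ^ 2 + ‖T x‖ ^ 2 := by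
        field_simp
      linarith
    exact le_of_sq_le_sq h1 (by positivity)

/-- Weighted Young inequality for the norm of a sum. -/
lemma norm_add_sq_le_weighted {β : ℝ} (hβ : 1 < β) (a b : E) :
    ‖a + b‖ ^ 2 ≤ β * ‖a‖ ^ 2 + β / (β - 1) * ‖b‖ ^ 2 := by
  have h0 : 0 < β - 1 := by linarith
  have h := real_inner_self_nonneg (x := (β - 1) • a - b)
  rw [real_inner_self_eq_norm_sq, norm_sub_sq_real, norm_smul, inner_smul_left, mul_pow,
    Real.norm_eq_abs, sq_abs, conj_trivial] at h
  rw [norm_add_sq_real]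
  have e : β * ‖a‖ ^ 2 + β / (β - 1) * ‖b‖ ^ 2 - (‖a‖ ^ 2 + 2 * ⟪a, b⟫ + ‖b‖ ^ 2)
      = ((β - 1) ^ 2 * ‖a‖ ^ 2 - 2 * ((β - 1) * ⟪a, b⟫) + ‖b‖ ^ 2) / (β - 1) := by
    field_simp
    ring
  have := div_nonneg h h0.le
  linarith

/-- One-step contraction of the primal-dual error, from a perturbed optimality relation. -/
lemma primal_dual_contraction {m M α ε ζ β φ lam δ δt : ℝ} (hm : 0 < m) (hM : 0 < M)
    (hα : 0 < α) (hε : 0 < ε) (hζ : 0 < ζ) (hβ : 1 < β) (hφ : 1 < φ) (hlam : 0 < lam)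
    (hδ : 0 < δ)
    (hδa : δ ≤ 2 * m * M / ((m + M) * ε) - 1 / (ε * ζ))
    (hδb : δ ≤ (α * ε - 8 * M ^ 2 * α * ζ) * (φ - 1) * (β - 1) * lam
        / (β * ε ^ 2 * (φ - 1) + 8 * M ^ 2 * β * (β - 1) * φ))
    (hδc : δ ≤ 2 * α * lam / ((m + M) * φ * β))
    {g p d e r w w₀ s y x₀ : E}
    (hg : m * M * ‖y‖ ^ 2 + ‖g‖ ^ 2 ≤ (m + M) * ⟪g, y⟫)
    (hopt : g + p + ε • d + e = 0) (hw : w = w₀ + α • s) (hy : y = x₀ + d)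
    (hps : ⟪p, y⟫ = ⟪w, s⟫) (hp : lam * ‖w‖ ^ 2 ≤ ‖p‖ ^ 2)
    (he : ‖e‖ ^ 2 ≤ 8 * M ^ 2 * ‖d‖ ^ 2 + 2 * ‖r‖ ^ 2)
    (hr : 2 * (α * ζ + δ * β * φ / ((φ - 1) * lam)) * ‖r‖ ^ 2
      ≤ δt * (‖w₀‖ ^ 2 + α * ε * ‖x₀‖ ^ 2)) :
    ‖w‖ ^ 2 + α * ε * ‖y‖ ^ 2
      ≤ (1 + δt) / (1 + δ) * (‖w₀‖ ^ 2 + α * ε * ‖x₀‖ ^ 2) := by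
  have hβ' : 0 < β - 1 := by linarith
  have hφ' : 0 < φ - 1 := by linarith
  have hβ0 : 0 < β := by linarith
  have hφ0 : 0 < φ := by linarith
  set C := α * ζ + δ * β * φ / ((φ - 1) * lam) with hC
  have hC0 : 0 ≤ C := by positivity
  have c1 : δ * (α * ε) ≤ 2 * α * m * M / (m + M) - α / ζ := by
    have := mul_le_mul_of_nonneg_right hδa (mul_pos hα hε).le
    refine this.trans_eq ?_
    field_simp
  have c2 : δ * β * φ / lam ≤ 2 * α / (m + M) := by
    rw [le_div_iff₀ (by positivity)] at hδc
    rw [div_le_div_iff₀ hlam (by positivity)]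
    linarith
  have c3 : 8 * M ^ 2 * C + δ * (β / (β - 1)) * ε ^ 2 / lam ≤ α * ε := by
    rw [le_div_iff₀ (by positivity)] at hδb
    have e1 : α * ε - (8 * M ^ 2 * C + δ * (β / (β - 1)) * ε ^ 2 / lam)
        = ((α * ε - 8 * M ^ 2 * α * ζ) * (φ - 1) * (β - 1) * lam
          - δ * (β * ε ^ 2 * (φ - 1) + 8 * M ^ 2 * β * (β - 1) * φ))
          / ((φ - 1) * (β - 1) * lam) := by
      rw [hC]
      field_simp
      ring
    have := div_nonneg (sub_nonneg.2 hδb) (by positivity : 0 ≤ (φ - 1) * (β - 1) * lam)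
    linarith
  have c4 : δ * ‖w‖ ^ 2 ≤ δ * β * φ / lam * ‖g‖ ^ 2
      + δ * β * φ / ((φ - 1) * lam) * ‖e‖ ^ 2
      + δ * (β / (β - 1)) * ε ^ 2 / lam * ‖d‖ ^ 2 := by
    have h1 : ‖p‖ = ‖(g + e) + ε • d‖ := by
      rw [← norm_neg p]
      congr 1
      rw [← sub_eq_zero, ← neg_eq_zero, ← hopt]
      abel
    have h2 := norm_add_sq_le_weighted hβ (g + e) (ε • d)
    have h3 := mul_le_mul_of_nonneg_left (norm_add_sq_le_weighted hφ g e) hβ0.le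
    rw [← h1, norm_smul, mul_pow, Real.norm_eq_abs, sq_abs] at h2
    have h4 := mul_le_mul_of_nonneg_left (hp.trans (h2.trans (add_le_add_left h3 _)))
      (div_pos hδ hlam).le
    have e1 : δ / lam * (lam * ‖w‖ ^ 2) = δ * ‖w‖ ^ 2 := by field_simp
    rw [e1] at h4
    refine h4.trans_eq ?_
    field_simp
  have young : -(ζ * ‖e‖ ^ 2 + 1 / ζ * ‖y‖ ^ 2) ≤ 2 * ⟪e, y⟫ := by
    have h := real_inner_self_nonneg (x := ζ • e + y)
    rw [real_inner_self_eq_norm_sq, norm_add_sq_real, norm_smul, inner_smul_left, mul_pow,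
      Real.norm_eq_abs, sq_abs, conj_trivial] at h
    have := div_nonneg h hζ.le
    have e1 : (ζ ^ 2 * ‖e‖ ^ 2 + 2 * (ζ * ⟪e, y⟫) + ‖y‖ ^ 2) / ζ
        = ζ * ‖e‖ ^ 2 + 1 / ζ * ‖y‖ ^ 2 + 2 * ⟪e, y⟫ := by
      field_simp
      ring
    linarith
  have coco : 2 * α * m * M / (m + M) * ‖y‖ ^ 2 + 2 * α / (m + M) * ‖g‖ ^ 2
      ≤ 2 * α * ⟪g, y⟫ := by
    have := mul_le_mul_of_nonneg_left hg (by positivity : 0 ≤ 2 * α / (m + M))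
    have e1 : 2 * α / (m + M) * ((m + M) * ⟪g, y⟫) = 2 * α * ⟪g, y⟫ := by field_simp
    rw [e1] at this
    refine le_trans (le_of_eq ?_) this
    ring
  have hinner : ⟪g, y⟫ + ⟪w, s⟫ + ε * ⟪y, d⟫ + ⟪e, y⟫ = 0 := by
    have h : ⟪g + p + ε • d + e, y⟫ = 0 := by rw [hopt, inner_zero_left]
    rw [inner_add_left, inner_add_left, inner_add_left, inner_smul_left, hps, conj_trivial,
      real_inner_comm y d] at h
    exact h
  have hw0 : ‖w₀‖ ^ 2 = ‖w‖ ^ 2 - 2 * (α * ⟪w, s⟫) + α ^ 2 * ‖s‖ ^ 2 := by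
    rw [show w₀ = w - α • s by rw [hw]; abel, norm_sub_sq_real, inner_smul_right, norm_smul,
      mul_pow, Real.norm_eq_abs, sq_abs]
  have hx0 : ‖x₀‖ ^ 2 = ‖y‖ ^ 2 - 2 * ⟪y, d⟫ + ‖d‖ ^ 2 := by
    rw [show x₀ = y - d by rw [hy]; abel, norm_sub_sq_real]
  have hid : ‖w₀‖ ^ 2 + α * ε * ‖x₀‖ ^ 2 = ‖w‖ ^ 2 + α * ε * ‖y‖ ^ 2 + α ^ 2 * ‖s‖ ^ 2
      + α * ε * ‖d‖ ^ 2 + 2 * α * ⟪g, y⟫ + 2 * α * ⟪e, y⟫ := by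
    rw [hw0, hx0]
    linear_combination (-2 * α) * hinner
  have t1 := mul_le_mul_of_nonneg_right c1 (sq_nonneg ‖y‖)
  have t2 := mul_le_mul_of_nonneg_right c2 (sq_nonneg ‖g‖)
  have t3 := mul_le_mul_of_nonneg_right c3 (sq_nonneg ‖d‖)
  have t4 := mul_le_mul_of_nonneg_left young hα.le
  have t5 := mul_le_mul_of_nonneg_left he hC0
  have t6 : 0 ≤ α ^ 2 * ‖s‖ ^ 2 := by positivity
  have e5 : C * ‖e‖ ^ 2 = α * ζ * ‖e‖ ^ 2 + δ * β * φ / ((φ - 1) * lam) * ‖e‖ ^ 2 := by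
    rw [hC]; ring
  have e4 : α * (1 / ζ * ‖y‖ ^ 2) = α / ζ * ‖y‖ ^ 2 := by ring
  rw [div_mul_eq_mul_div, le_div_iff₀ (by linarith)]
  nlinarith only [t1, t2, t3, t4, t5, t6, e4, e5, c4, coco, hid, hr]

/-- A map whose derivative stays within `r` of `c • id` is, up to the linear part `c • id`,
Lipschitz with constant `r`. -/
lemma norm_sub_sub_smul_le_of_hasFDerivAt {g : E → E} {g' : E → E →L[ℝ] E} {c r : ℝ}
    (hg : ∀ x, HasFDerivAt g (g' x) x)
    (hr : ∀ x, ‖g' x - c • ContinuousLinearMap.id ℝ E‖ ≤ r) (x y : E) :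
    ‖g x - g y - c • (x - y)‖ ≤ r * ‖x - y‖ := by
  have h := Convex.norm_image_sub_le_of_norm_hasFDerivWithin_le
    (f := fun z => g z - c • z) (fun z _ =>
      ((hg z).sub ((hasFDerivAt_id z).const_smul c)).hasFDerivWithinAt)
    (fun z _ => hr z) convex_univ (Set.mem_univ y) (Set.mem_univ x)
  refine le_trans (le_of_eq ?_) h
  congr 1
  rw [smul_sub]
  abel

end InnerProduct

section MatrixAction

variable {ι : Type*} [Fintype ι] [DecidableEq ι]

lemma inner_mApp_of_isHermitian {A : Matrix ι ι ℝ} (hA : A.IsHermitian)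
    (x y : EuclideanSpace ℝ ι) : ⟪mApp A x, y⟫ = ⟪x, mApp A y⟫ :=
  Matrix.isSymmetric_toEuclideanLin_iff.2 hA x y

lemma mApp_mul (A B : Matrix ι ι ℝ) (x : EuclideanSpace ℝ ι) :
    mApp (A * B) x = mApp A (mApp B x) := by
  simp [mApp, map_mul]

lemma mApp_add (A : Matrix ι ι ℝ) (x y : EuclideanSpace ℝ ι) :
    mApp A (x + y) = mApp A x + mApp A y :=
  map_add _ _ _

lemma mApp_sub (A : Matrix ι ι ℝ) (x y : EuclideanSpace ℝ ι) :
    mApp A (x - y) = mApp A x - mApp A y :=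
  map_sub _ _ _

lemma mApp_smul (A : Matrix ι ι ℝ) (c : ℝ) (x : EuclideanSpace ℝ ι) :
    mApp A (c • x) = c • mApp A x :=
  map_smul _ _ _

lemma inner_mApp_nonneg {A : Matrix ι ι ℝ} (hA : A.PosSemidef) (x : EuclideanSpace ℝ ι) :
    0 ≤ ⟪x, mApp A x⟫ := by
  rw [mApp, Matrix.inner_toEuclideanCLM]
  simpa using hA.dotProduct_mulVec_nonneg x.ofLp

/-- A matrix squeezed between `m` and `M` is within `(M - m) / 2` of its midpoint. -/
lemma norm_toEuclideanCLM_sub_midpoint_le {A : Matrix ι ι ℝ} {m M : ℝ} (hmM : m ≤ M)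
    (hlow : (A - m • (1 : Matrix ι ι ℝ)).PosSemidef)
    (hup : (M • (1 : Matrix ι ι ℝ) - A).PosSemidef) :
    ‖Matrix.toEuclideanCLM (𝕜 := ℝ) A
      - ((m + M) / 2) • ContinuousLinearMap.id ℝ (EuclideanSpace ℝ ι)‖ ≤ (M - m) / 2 := by
  have hA : A.IsHermitian := by
    have := hlow.1.add (Matrix.isHermitian_one.smul (k := m) (IsSelfAdjoint.all m))
    simpa using this
  have hlow' : ∀ x : EuclideanSpace ℝ ι, m * ‖x‖ ^ 2 ≤ ⟪x, mApp A x⟫ := fun x => by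
    have := inner_mApp_nonneg hlow x
    simp only [mApp, map_sub, map_smul, map_one, sub_apply,
      smul_apply, one_apply_eq_self, inner_sub_right,
      inner_smul_right, real_inner_self_eq_norm_sq] at this ⊢
    linarith
  have hup' : ∀ x : EuclideanSpace ℝ ι, ⟪x, mApp A x⟫ ≤ M * ‖x‖ ^ 2 := fun x => by
    have := inner_mApp_nonneg hup x
    simp only [mApp, map_sub, map_smul, map_one, sub_apply,
      smul_apply, one_apply_eq_self, inner_sub_right,
      inner_smul_right, real_inner_self_eq_norm_sq] at this ⊢
    linarith
  have hval : ∀ x, (Matrix.toEuclideanCLM (𝕜 := ℝ) A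
      - ((m + M) / 2) • ContinuousLinearMap.id ℝ (EuclideanSpace ℝ ι)) x
      = mApp A x - ((m + M) / 2) • x := fun x => rfl
  refine norm_le_of_abs_inner_self_le ?_ (by linarith) ?_ ?_
  · intro x y
    rw [hval, hval, inner_sub_left, inner_sub_right, inner_mApp_of_isHermitian hA,
      inner_smul_left, inner_smul_right, conj_trivial]
  · intro x
    rw [hval, inner_sub_right, inner_smul_right, real_inner_self_eq_norm_sq]
    linarith [hlow' x]
  · intro x
    rw [hval, inner_sub_right, inner_smul_right, real_inner_self_eq_norm_sq]
    linarith [hup' x]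

/-- On the orthogonal complement of the kernel, the quadratic form of a Hermitian matrix is at
least any lower bound of the nonzero eigenvalues. -/
lemma mul_norm_sq_le_inner_mApp {A : Matrix ι ι ℝ} (hA : A.IsHermitian) {lam : ℝ}
    (hmin : ∀ μ ∈ spectrum ℝ A, μ ≠ 0 → lam ≤ μ) {w : EuclideanSpace ℝ ι}
    (horth : ∀ z, mApp A z = 0 → ⟪w, z⟫ = 0) :
    lam * ‖w‖ ^ 2 ≤ ⟪w, mApp A w⟫ := by
  have heig : ∀ i, mApp A (hA.eigenvectorBasis i)
      = hA.eigenvalues i • hA.eigenvectorBasis i := fun i => by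
    ext j
    exact congrFun (hA.mulVec_eigenvectorBasis i) j
  rw [← hA.eigenvectorBasis.sum_inner_mul_inner, ← real_inner_self_eq_norm_sq,
    ← hA.eigenvectorBasis.sum_inner_mul_inner w w, Finset.mul_sum]
  refine Finset.sum_le_sum fun i _ => ?_
  rw [← inner_mApp_of_isHermitian hA, heig, inner_smul_left, conj_trivial,
    real_inner_comm w (hA.eigenvectorBasis i)]
  rcases eq_or_ne (hA.eigenvalues i) 0 with h0 | h0
  · have : ⟪w, hA.eigenvectorBasis i⟫ = 0 := horth _ (by rw [heig, h0, zero_smul])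
    simp [this]
  · have := hmin _ (hA.eigenvalues_mem_spectrum_real i) h0
    nlinarith [mul_self_nonneg ⟪w, hA.eigenvectorBasis i⟫]

/-- A doubly stochastic matrix has numerical range in `[-1, 1]`; this is the lower bound. -/
lemma neg_norm_sq_le_inner_mApp {A : Matrix ι ι ℝ} (hnn : ∀ i j, 0 ≤ A i j)
    (hrow : ∀ i, ∑ j, A i j = 1) (hcol : ∀ j, ∑ i, A i j = 1) (x : EuclideanSpace ℝ ι) :
    -‖x‖ ^ 2 ≤ ⟪x, mApp A x⟫ := by
  rw [mApp, Matrix.inner_toEuclideanCLM, EuclideanSpace.real_norm_sq_eq]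
  have e1 : ∑ i, ∑ j, A i j * x i ^ 2 = ∑ i, x i ^ 2 := by
    simp_rw [← Finset.sum_mul, hrow, one_mul]
  have e2 : ∑ i, ∑ j, A i j * x j ^ 2 = ∑ i, x i ^ 2 := by
    rw [Finset.sum_comm]
    simp_rw [← Finset.sum_mul, hcol, one_mul]
  have e3 : x.ofLp ⬝ᵥ A.mulVec x.ofLp = ∑ i, ∑ j, A i j * (x i * x j) := by
    simp only [dotProduct, Matrix.mulVec, Finset.mul_sum]
    exact Finset.sum_congr rfl fun i _ => Finset.sum_congr rfl fun j _ => by ring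
  have h : 0 ≤ ∑ i, ∑ j, A i j * (x i + x j) ^ 2 :=
    Finset.sum_nonneg fun i _ => Finset.sum_nonneg fun j _ => mul_nonneg (hnn i j) (sq_nonneg _)
  have e4 : ∑ i, ∑ j, A i j * (x i + x j) ^ 2 = ∑ i, ∑ j, A i j * x i ^ 2
      + 2 * (∑ i, ∑ j, A i j * (x i * x j)) + ∑ i, ∑ j, A i j * x j ^ 2 := by
    simp only [Finset.mul_sum, ← Finset.sum_add_distrib]
    exact Finset.sum_congr rfl fun i _ => Finset.sum_congr rfl fun j _ => by ring
  rw [e3]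
  linarith

end MatrixAction

section Network

variable {N n : ℕ}

lemma sum_WW_row {W : Matrix (Fin N) (Fin N) ℝ} (hW : ∀ i, ∑ j, W i j = 1) (p : Fin N × Fin n) :
    ∑ q, WW N n W p q = 1 := by
  simp [WW, Fintype.sum_prod_type, Matrix.one_apply, hW]

lemma sum_WW_col {W : Matrix (Fin N) (Fin N) ℝ} (hW : ∀ j, ∑ i, W i j = 1) (q : Fin N × Fin n) :
    ∑ p, WW N n W p q = 1 := by
  simp [WW, Fintype.sum_prod_type, Matrix.one_apply, hW]

lemma WW_nonneg {W : Matrix (Fin N) (Fin N) ℝ} (hW : ∀ i j, 0 ≤ W i j) (p q : Fin N × Fin n) :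
    0 ≤ WW N n W p q :=
  mul_nonneg (hW _ _) (by rw [Matrix.one_apply]; split_ifs <;> simp)

/-- A symmetric square root of `I - 𝕎` has squared norm at most `2`. -/
lemma norm_mApp_sqrt_sq_le {W : Matrix (Fin N) (Fin N) ℝ} (hnn : ∀ i j, 0 ≤ W i j)
    (hrow : ∀ i, ∑ j, W i j = 1) (hcol : ∀ j, ∑ i, W i j = 1)
    {S : Matrix (Fin N × Fin n) (Fin N × Fin n) ℝ} (hS : S.IsHermitian)
    (hSsq : S * S = 1 - WW N n W) (z : EuclideanSpace ℝ (Fin N × Fin n)) :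
    ‖mApp S z‖ ^ 2 ≤ 2 * ‖z‖ ^ 2 := by
  have h := neg_norm_sq_le_inner_mApp (WW_nonneg (n := n) hnn) (sum_WW_row hrow)
    (sum_WW_col hcol) z
  have e : mApp (1 - WW N n W) z = z - mApp (WW N n W) z := by simp [mApp]
  rw [← real_inner_self_eq_norm_sq, inner_mApp_of_isHermitian hS, ← mApp_mul, hSsq, e,
    inner_sub_right, real_inner_self_eq_norm_sq]
  linarith

lemma norm_sq_eq_sum_comp (x : EuclideanSpace ℝ (Fin N × Fin n)) :
    ‖x‖ ^ 2 = ∑ i, ‖comp N n x i‖ ^ 2 := by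
  simp only [EuclideanSpace.real_norm_sq_eq, Fintype.sum_prod_type]
  rfl

/-- The gradient of a separable function acts blockwise. -/
lemma comp_gradient_sum {F : Fin N → EuclideanSpace ℝ (Fin n) → ℝ}
    (hF : ∀ i, Differentiable ℝ (F i)) {f : EuclideanSpace ℝ (Fin N × Fin n) → ℝ}
    (hf : ∀ x, f x = ∑ i, F i (comp N n x i)) (x : EuclideanSpace ℝ (Fin N × Fin n))
    (i : Fin N) : comp N n (gradient f x) i = gradient (F i) (comp N n x i) := by
  let P : Fin N → EuclideanSpace ℝ (Fin N × Fin n) →L[ℝ] EuclideanSpace ℝ (Fin n) := fun i =>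
    LinearMap.toContinuousLinearMap
      { toFun := fun x => comp N n x i
        map_add' := fun _ _ => rfl
        map_smul' := fun _ _ => rfl }
  have hP : ∀ i x, P i x = comp N n x i := fun _ _ => rfl
  have hd : HasFDerivAt f (∑ i, (fderiv ℝ (F i) (comp N n x i)).comp (P i)) x := by
    rw [show f = fun x => ∑ i, F i (comp N n x i) from funext hf]
    refine HasFDerivAt.fun_sum fun i _ => ?_
    exact ((hF i (comp N n x i)).hasFDerivAt).comp x (P i).hasFDerivAt
  let G : EuclideanSpace ℝ (Fin N × Fin n) :=
    WithLp.toLp 2 fun p => gradient (F p.1) (comp N n x p.1) p.2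
  have hG : HasGradientAt f G x := by
    refine hasGradientAt_iff_hasFDerivAt.2 (hd.congr_fderiv ?_)
    ext h
    symm
    simp only [InnerProductSpace.toDual_apply_apply, sum_apply,
      ContinuousLinearMap.comp_apply, ← inner_gradient_left, hP]
    simp only [PiLp.inner_apply, Fintype.sum_prod_type]
    rfl
  rw [hG.gradient]
  rfl

/-- The gradient of a separable function inherits the midpoint Lipschitz bound of its blocks. -/
lemma norm_gradient_sub_midpoint_le {m M : ℝ} (hmM : m ≤ M)
    {F : Fin N → EuclideanSpace ℝ (Fin n) → ℝ} (hF : ∀ i, Differentiable ℝ (F i))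
    {HF : Fin N → EuclideanSpace ℝ (Fin n) → Matrix (Fin n) (Fin n) ℝ}
    (hHF : ∀ i y, HasFDerivAt (gradient (F i)) (Matrix.toEuclideanCLM (𝕜 := ℝ) (HF i y)) y)
    (hlow : ∀ i y, (HF i y - m • (1 : Matrix (Fin n) (Fin n) ℝ)).PosSemidef)
    (hup : ∀ i y, (M • (1 : Matrix (Fin n) (Fin n) ℝ) - HF i y).PosSemidef)
    {f : EuclideanSpace ℝ (Fin N × Fin n) → ℝ} (hf : ∀ x, f x = ∑ i, F i (comp N n x i))
    (x y : EuclideanSpace ℝ (Fin N × Fin n)) :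
    ‖gradient f x - gradient f y - ((m + M) / 2) • (x - y)‖ ≤ (M - m) / 2 * ‖x - y‖ := by
  have h0 : 0 ≤ (M - m) / 2 := by linarith
  refine le_of_sq_le_sq ?_ (by positivity)
  rw [mul_pow, norm_sq_eq_sum_comp, norm_sq_eq_sum_comp (x - y), Finset.mul_sum]
  refine Finset.sum_le_sum fun i _ => ?_
  rw [← mul_pow]
  have h := norm_sub_sub_smul_le_of_hasFDerivAt (hHF i)
    (fun z => norm_toEuclideanCLM_sub_midpoint_le hmM (hlow i z) (hup i z))
    (comp N n x i) (comp N n y i)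
  rw [← comp_gradient_sum hF hf, ← comp_gradient_sum hF hf] at h
  exact pow_le_pow_left₀ (norm_nonneg _) h 2

end Network

theorem stmt8
    (N n : ℕ) (hN : 1 ≤ N) (hn : 1 ≤ n)
    (W : Matrix (Fin N) (Fin N) ℝ)
    (hWsymm : W.IsSymm)
    (hWnonneg : ∀ i j, 0 ≤ W i j)
    (hWrow : ∀ i, ∑ j, W i j = 1)
    (hWcol : ∀ j, ∑ i, W i j = 1)
    (hWdiagpos : ∀ i, 0 < W i i)
    (m M : ℝ) (hm : 0 < m) (hmM : m ≤ M)
    (F : Fin N → EuclideanSpace ℝ (Fin n) → ℝ)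
    (hFsmooth : ∀ i, ContDiff ℝ 2 (F i))
    (HF : Fin N → EuclideanSpace ℝ (Fin n) → Matrix (Fin n) (Fin n) ℝ)
    (hHF : ∀ i y, HasFDerivAt (gradient (F i)) (Matrix.toEuclideanCLM (𝕜 := ℝ) (HF i y)) y)
    (hHFlow : ∀ i y, (HF i y - m • (1 : Matrix (Fin n) (Fin n) ℝ)).PosSemidef)
    (hHFup : ∀ i y, (M • (1 : Matrix (Fin n) (Fin n) ℝ) - HF i y).PosSemidef)
    (f : EuclideanSpace ℝ (Fin N × Fin n) → ℝ)
    (hf : ∀ x, f x = ∑ i, F i (comp N n x i))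
    (Hf : EuclideanSpace ℝ (Fin N × Fin n) → Matrix (Fin N × Fin n) (Fin N × Fin n) ℝ)
    (hHfderiv : ∀ x, HasFDerivAt (gradient f) (Matrix.toEuclideanCLM (𝕜 := ℝ) (Hf x)) x)
    (L : ℝ) (hL : 0 < L)
    (hLip : ∀ x z, specNorm (Hf x - Hf z) ≤ L * ‖x - z‖)
    (S : Matrix (Fin N × Fin n) (Fin N × Fin n) ℝ)
    (hSpsd : S.PosSemidef)
    (hSsq : S * S = 1 - WW N n W)
    (xstar vstar : EuclideanSpace ℝ (Fin N × Fin n))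
    (hopt1 : gradient f xstar + mApp S vstar = 0)
    (hopt2 : mApp S xstar = 0)
    (α ε : ℝ) (hα : 0 < α) (hε : 0 < ε)
    (xk vk : EuclideanSpace ℝ (Fin N × Fin n))
    (qk : EuclideanSpace ℝ (Fin N × Fin n)) (hqk : qk = mApp S vk)
    (gk : EuclideanSpace ℝ (Fin N × Fin n))
    (hgk : gk = gradient f xk + qk + α • mApp (1 - WW N n W) xk)
    (Hk : Matrix (Fin N × Fin n) (Fin N × Fin n) ℝ)
    (hHk : Hk = Hf xk + α • ((1 : Matrix (Fin N × Fin n) (Fin N × Fin n) ℝ) - WW N n W) + ε • 1)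
    (dk rk : EuclideanSpace ℝ (Fin N × Fin n))
    (hstep : mApp Hk dk = -gk + rk)
    (xk1 : EuclideanSpace ℝ (Fin N × Fin n)) (hx1 : xk1 = xk + dk)
    (vk1 : EuclideanSpace ℝ (Fin N × Fin n)) (hv1 : vk1 = vk + α • mApp S xk1)
    (qk1 : EuclideanSpace ℝ (Fin N × Fin n)) (hq1 : qk1 = qk + α • mApp (1 - WW N n W) xk1)
    (ek : EuclideanSpace ℝ (Fin N × Fin n))
    (hek : ek = mApp (Hf xk) dk + gradient f xk - gradient f xk1 - rk)
    (ηk : ℝ) (hηk : 0 ≤ ηk) (hres : ‖rk‖ ≤ ηk * ‖gk‖)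
    (lam2 : ℝ) (hlam2pos : 0 < lam2)
    (hWneI : W ≠ 1)
    (hlam2mem : lam2 ∈ spectrum ℝ ((1 : Matrix (Fin N × Fin n) (Fin N × Fin n) ℝ) - WW N n W))
    (hlam2min : ∀ μ ∈ spectrum ℝ ((1 : Matrix (Fin N × Fin n) (Fin N × Fin n) ℝ) - WW N n W),
      μ ≠ 0 → lam2 ≤ μ)
    (horth : ∀ z : EuclideanSpace ℝ (Fin N × Fin n),
      mApp (1 - WW N n W) z = 0 → ⟪vk1 - vstar, z⟫ = 0)
    (ζ : ℝ) (hζlow : (m + M) / (2 * m * M) < ζ) (hζup : ζ < ε / (8 * M ^ 2))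
    (β φ : ℝ) (hβ : 1 < β) (hφ : 1 < φ)
    (δa δb δ δt : ℝ)
    (hδa : δa = 2 * m * M / ((m + M) * ε) - 1 / (ε * ζ))
    (hδb : δb = min
      ((α * ε - 8 * M ^ 2 * α * ζ) * (φ - 1) * (β - 1) * lam2
        / (β * ε ^ 2 * (φ - 1) + 8 * M ^ 2 * β * (β - 1) * φ))
      (2 * α * lam2 / ((m + M) * φ * β)))
    (hδpos : 0 < δ) (hδle : δ ≤ min δa δb)
    (hδtpos : 0 < δt) (hδtlt : δt < δ)
    (hηbound : ηk ^ 2 ≤ min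
      (δt * α * ε / (4 * (M + 2 * α) ^ 2 * (α * ζ + δ * β * φ / ((φ - 1) * lam2))))
      (δt / (8 * (α * ζ + δ * β * φ / ((φ - 1) * lam2))))) :
    ‖vk1 - vstar‖ ^ 2 + α * ε * ‖xk1 - xstar‖ ^ 2
      ≤ ((1 + δt) / (1 + δ)) * (‖vk - vstar‖ ^ 2 + α * ε * ‖xk - xstar‖ ^ 2) := by
  have hM : 0 < M := hm.trans_le hmM
  have hζ : 0 < ζ := lt_trans (by positivity) hζlow
  have hβ' : 0 < β - 1 := by linarith
  have hφ' : 0 < φ - 1 := by linarith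
  have hS : S.IsHermitian := hSpsd.1
  have hmid := norm_gradient_sub_midpoint_le hmM
    (fun i => (hFsmooth i).differentiable (by norm_num)) hHF hHFlow hHFup hf
  have hgradLip : ∀ x z, ‖gradient f x - gradient f z‖ ≤ M * ‖x - z‖ := fun x z => by
    have h := norm_add_le (gradient f x - gradient f z - ((m + M) / 2) • (x - z))
      (((m + M) / 2) • (x - z))
    rw [sub_add_cancel, norm_smul, Real.norm_of_nonneg (by linarith)] at h
    linarith [hmid x z]
  have hHess : ‖mApp (Hf xk) dk‖ ≤ M * ‖dk‖ :=
    ContinuousLinearMap.le_of_opNorm_le _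
      ((hHfderiv xk).le_of_lip' hM.le (Eventually.of_forall fun x => hgradLip x xk)) dk
  have hSnorm := norm_mApp_sqrt_sq_le hWnonneg hWrow hWcol hS hSsq
  have hLapnorm : ∀ z, ‖mApp (1 - WW N n W) z‖ ≤ 2 * ‖z‖ := fun z => by
    refine le_of_sq_le_sq ?_ (by positivity)
    rw [← hSsq, mApp_mul]
    linarith [hSnorm (mApp S z), hSnorm z]
  have hLapstar : mApp (1 - WW N n W) xstar = 0 := by
    rw [← hSsq, mApp_mul, hopt2]
    exact map_zero _
  have hcoco : m * M * ‖xk1 - xstar‖ ^ 2 + ‖gradient f xk1 - gradient f xstar‖ ^ 2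
      ≤ (m + M) * ⟪gradient f xk1 - gradient f xstar, xk1 - xstar⟫ := by
    have h := pow_le_pow_left₀ (norm_nonneg _) (hmid xk1 xstar) 2
    rw [norm_sub_sq_real, inner_smul_right, norm_smul, mul_pow, mul_pow, Real.norm_eq_abs,
      sq_abs] at h
    linarith
  have herr : ‖ek‖ ^ 2 ≤ 8 * M ^ 2 * ‖dk‖ ^ 2 + 2 * ‖rk‖ ^ 2 := by
    have h1 : ‖mApp (Hf xk) dk + (gradient f xk - gradient f xk1)‖ ≤ 2 * M * ‖dk‖ := by
      have h2 := hgradLip xk1 xk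
      rw [hx1, add_sub_cancel_left, ← hx1, norm_sub_rev] at h2
      linarith [norm_add_le (mApp (Hf xk) dk) (gradient f xk - gradient f xk1)]
    have h3 := norm_add_sq_le_weighted one_lt_two
      (mApp (Hf xk) dk + (gradient f xk - gradient f xk1)) (-rk)
    rw [show mApp (Hf xk) dk + (gradient f xk - gradient f xk1) + -rk = ek by
      rw [hek]; abel, norm_neg] at h3
    have h4 := pow_le_pow_left₀ (norm_nonneg _) h1 2
    norm_num at h3
    nlinarith
  have hgnorm : ‖gk‖ ^ 2
      ≤ 2 * (M + 2 * α) ^ 2 * ‖xk - xstar‖ ^ 2 + 4 * ‖vk - vstar‖ ^ 2 := by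
    have h1 : gk = (gradient f xk - gradient f xstar + α • mApp (1 - WW N n W) (xk - xstar))
        + mApp S (vk - vstar) := by
      rw [mApp_sub, mApp_sub, hLapstar, hgk, hqk, eq_neg_of_add_eq_zero_left hopt1, sub_zero]
      abel
    have h2 : ‖gradient f xk - gradient f xstar + α • mApp (1 - WW N n W) (xk - xstar)‖
        ≤ (M + 2 * α) * ‖xk - xstar‖ := by
      refine (norm_add_le _ _).trans ?_
      rw [norm_smul, Real.norm_of_nonneg hα.le]
      linarith [hgradLip xk xstar, mul_le_mul_of_nonneg_left (hLapnorm (xk - xstar)) hα.le]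
    have h3 := norm_add_sq_le_weighted one_lt_two
      (gradient f xk - gradient f xstar + α • mApp (1 - WW N n W) (xk - xstar))
      (mApp S (vk - vstar))
    rw [← h1] at h3
    have h4 := pow_le_pow_left₀ (norm_nonneg _) h2 2
    norm_num at h3
    linarith [hSnorm (vk - vstar)]
  have hresid : 2 * (α * ζ + δ * β * φ / ((φ - 1) * lam2)) * ‖rk‖ ^ 2
      ≤ δt * (‖vk - vstar‖ ^ 2 + α * ε * ‖xk - xstar‖ ^ 2) := by
    have hC : 0 < α * ζ + δ * β * φ / ((φ - 1) * lam2) := by positivity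
    set C := α * ζ + δ * β * φ / ((φ - 1) * lam2)
    have h1 := hηbound.trans (min_le_left _ _)
    have h2 := hηbound.trans (min_le_right _ _)
    rw [le_div_iff₀ (by positivity)] at h1 h2
    have h3 := pow_le_pow_left₀ (norm_nonneg _) hres 2
    rw [mul_pow] at h3
    have h4 := h3.trans (mul_le_mul_of_nonneg_left hgnorm (sq_nonneg ηk))
    have h5 := mul_le_mul_of_nonneg_left h4 (by positivity : 0 ≤ 2 * C)
    have h6 := mul_le_mul_of_nonneg_right h1 (sq_nonneg ‖xk - xstar‖)
    have h7 := mul_le_mul_of_nonneg_right h2 (sq_nonneg ‖vk - vstar‖)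
    linarith
  have hopt : (gradient f xk1 - gradient f xstar) + mApp S (vk1 - vstar) + ε • dk + ek = 0 := by
    have h1 : mApp Hk dk = mApp (Hf xk) dk + α • mApp (1 - WW N n W) dk + ε • dk := by
      simp only [hHk, mApp, map_add, map_smul, map_one, add_apply,
        smul_apply, one_apply_eq_self]
    have h2 : mApp S vk1 = mApp S vk + α • mApp (1 - WW N n W) xk
        + α • mApp (1 - WW N n W) dk := by
      rw [hv1, mApp_add, mApp_smul, ← mApp_mul, hSsq, hx1, mApp_add, smul_add, add_assoc]
    have h3 : mApp (Hf xk) dk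
        = -gk + rk - α • mApp (1 - WW N n W) dk - ε • dk := by
      rw [← hstep, h1]; abel
    rw [mApp_sub, h2, hek, h3, hgk, hqk, eq_neg_of_add_eq_zero_left hopt1]
    abel
  have hSstar : mApp S (xk1 - xstar) = mApp S xk1 := by rw [mApp_sub, hopt2, sub_zero]
  have hLap : (1 - WW N n W).IsHermitian := by
    rw [← hSsq, Matrix.IsHermitian, Matrix.conjTranspose_mul, hS.eq]
  have hspec : lam2 * ‖vk1 - vstar‖ ^ 2 ≤ ‖mApp S (vk1 - vstar)‖ ^ 2 := by
    have h := mul_norm_sq_le_inner_mApp hLap hlam2min horth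
    rwa [← hSsq, mApp_mul, ← inner_mApp_of_isHermitian hS, real_inner_self_eq_norm_sq] at h
  have hδa' := hδle.trans (min_le_left _ _)
  have hδb' := hδle.trans (min_le_right _ _)
  rw [hδa] at hδa'
  rw [hδb] at hδb'
  exact primal_dual_contraction hm hM hα hε hζ hβ hφ hlam2pos hδpos hδa'
    (hδb'.trans (min_le_left _ _)) (hδb'.trans (min_le_right _ _)) hcoco hopt
    (by rw [hv1]; abel) (by rw [hx1]; abel)
    (by rw [inner_mApp_of_isHermitian hS, hSstar]) hspec herr hresid
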